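/- Assume an optimal pair exists and v* ∈ ℝ. Then for every η > 0, the value of the reduced problem equals the value of the original problem: v*_η = v*. -/

import Mathlib

open MeasureTheory Set

noncomputable section

/-- An admissible pair `(y,u)` on the time interval `[t₀,t₁]`: the control `u` is
measurable with values in `U`, the trajectory `y` stays in `X`, and `y` is absolutely
continuous with `y'(s) = f (y s) (u s)` for a.e. `s ∈ [t₀,t₁]` (expressed by the
integral representation). -/
def IsAdmissible {d m : ℕ} (X : Set (EuclideanSpace ℝ (Fin d)))
    (U : Set (EuclideanSpace ℝ (Fin m)))
    (f : EuclideanSpace ℝ (Fin d) → EuclideanSpace ℝ (Fin m) → EuclideanSpace ℝ (Fin d))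
    (t₀ t₁ : ℝ) (y : ℝ → EuclideanSpace ℝ (Fin d))
    (u : ℝ → EuclideanSpace ℝ (Fin m)) : Prop :=
  Measurable u ∧ (∀ s ∈ Icc t₀ t₁, u s ∈ U) ∧ (∀ s ∈ Icc t₀ t₁, y s ∈ X) ∧
    ∀ t ∈ Icc t₀ t₁, y t = y t₀ + ∫ s in t₀..t, f (y s) (u s)

/-- The optimal value `v*` of the finite-horizon problem, as an extended real. -/
def vStar {d m : ℕ} (X : Set (EuclideanSpace ℝ (Fin d)))
    (U : Set (EuclideanSpace ℝ (Fin m)))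
    (f : EuclideanSpace ℝ (Fin d) → EuclideanSpace ℝ (Fin m) → EuclideanSpace ℝ (Fin d))
    (ℓ : EuclideanSpace ℝ (Fin d) → EuclideanSpace ℝ (Fin m) → ℝ)
    (φ₀ φT : EuclideanSpace ℝ (Fin d) → ℝ) (T : ℝ) : EReal :=
  ⨆ (p : (ℝ → EuclideanSpace ℝ (Fin d)) × (ℝ → EuclideanSpace ℝ (Fin m)))
    (_ : IsAdmissible X U f 0 T p.1 p.2),
      (((∫ s in (0:ℝ)..T, ℓ (p.1 s) (p.2 s)) + φ₀ (p.1 0) + φT (p.1 T) : ℝ) : EReal)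

/-- The backward value function `v←(x,t)`. -/
def vBack {d m : ℕ} (X : Set (EuclideanSpace ℝ (Fin d)))
    (U : Set (EuclideanSpace ℝ (Fin m)))
    (f : EuclideanSpace ℝ (Fin d) → EuclideanSpace ℝ (Fin m) → EuclideanSpace ℝ (Fin d))
    (ℓ : EuclideanSpace ℝ (Fin d) → EuclideanSpace ℝ (Fin m) → ℝ)
    (φT : EuclideanSpace ℝ (Fin d) → ℝ) (T : ℝ)
    (x : EuclideanSpace ℝ (Fin d)) (t : ℝ) : EReal :=
  ⨆ (p : (ℝ → EuclideanSpace ℝ (Fin d)) × (ℝ → EuclideanSpace ℝ (Fin m)))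
    (_ : IsAdmissible X U f t T p.1 p.2 ∧ p.1 t = x),
      (((∫ s in t..T, ℓ (p.1 s) (p.2 s)) + φT (p.1 T) : ℝ) : EReal)

/-- The forward value function `v→(x,t)`. -/
def vFor {d m : ℕ} (X : Set (EuclideanSpace ℝ (Fin d)))
    (U : Set (EuclideanSpace ℝ (Fin m)))
    (f : EuclideanSpace ℝ (Fin d) → EuclideanSpace ℝ (Fin m) → EuclideanSpace ℝ (Fin d))
    (ℓ : EuclideanSpace ℝ (Fin d) → EuclideanSpace ℝ (Fin m) → ℝ)
    (φ₀ : EuclideanSpace ℝ (Fin d) → ℝ)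
    (x : EuclideanSpace ℝ (Fin d)) (t : ℝ) : EReal :=
  ⨆ (p : (ℝ → EuclideanSpace ℝ (Fin d)) × (ℝ → EuclideanSpace ℝ (Fin m)))
    (_ : IsAdmissible X U f 0 t p.1 p.2 ∧ p.1 t = x),
      (((∫ s in (0:ℝ)..t, ℓ (p.1 s) (p.2 s)) + φ₀ (p.1 0) : ℝ) : EReal)

/-- A function that differs by a constant from the primitive of a bounded function is a.e. strongly
measurable, even if the integrand is not known to be integrable. -/
theorem aestronglyMeasurable_of_eq_add_integral {E : Type*} [NormedAddCommGroup E]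
    [NormedSpace ℝ E] {a b C : ℝ} {y g : ℝ → E} (hg : ∀ s, ‖g s‖ ≤ C)
    (hy : ∀ t ∈ Icc a b, y t = y a + ∫ s in a..t, g s) :
    AEStronglyMeasurable y (volume.restrict (Icc a b)) := by
  set A : Set ℝ := {t ∈ Icc a b | IntervalIntegrable g volume a t}
  have hA_meas : MeasurableSet A := by
    refine Set.OrdConnected.measurableSet ⟨fun s hs t ht r hr => ?_⟩
    have har : a ≤ r := hs.1.1.trans hr.1
    refine ⟨⟨har, hr.2.trans ht.1.2⟩, ht.2.mono_set ?_⟩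
    rw [uIcc_of_le har, uIcc_of_le (har.trans hr.2)]
    exact Icc_subset_Icc_right hr.2
  have hlip : LipschitzOnWith C.toNNReal y A := by
    refine LipschitzOnWith.of_dist_le_mul fun s hs t ht => ?_
    have hC : 0 ≤ C := (norm_nonneg _).trans (hg a)
    rw [dist_eq_norm, hy s hs.1, hy t ht.1, add_sub_add_left_eq_sub,
      intervalIntegral.integral_interval_sub_left hs.2 ht.2, Real.coe_toNNReal C hC,
      Real.dist_eq]
    exact intervalIntegral.norm_integral_le_of_norm_le_const fun r _ => hg r
  have hdiff : AEStronglyMeasurable y (volume.restrict (Icc a b \ A)) := by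
    refine (aestronglyMeasurable_const (b := y a)).congr ?_
    refine (ae_restrict_mem (measurableSet_Icc.diff hA_meas)).mono fun t ht => ?_
    have hnot : ¬ IntervalIntegrable g volume a t := fun h => ht.2 ⟨ht.1, h⟩
    simp [hy t ht.1, intervalIntegral.integral_undef hnot]
  have hunion : A ∪ Icc a b \ A = Icc a b := union_sdiff_cancel (sep_subset _ _)
  rw [← hunion, aestronglyMeasurable_union_iff]
  exact ⟨hlip.continuousOn.aestronglyMeasurable hA_meas, hdiff⟩

section Admissible

variable {d m : ℕ} {X : Set (EuclideanSpace ℝ (Fin d))} {U : Set (EuclideanSpace ℝ (Fin m))}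
  {f : EuclideanSpace ℝ (Fin d) → EuclideanSpace ℝ (Fin m) → EuclideanSpace ℝ (Fin d)}
  {t₀ t₁ s : ℝ} {y : ℝ → EuclideanSpace ℝ (Fin d)} {u : ℝ → EuclideanSpace ℝ (Fin m)}

/-- Bounded continuous functions are integrable along admissible pairs. -/
theorem IsAdmissible.intervalIntegrable {E : Type*} [NormedAddCommGroup E]
    {F : EuclideanSpace ℝ (Fin d) → EuclideanSpace ℝ (Fin m) → E}
    (h : IsAdmissible X U f t₀ t₁ y u) (ht : t₀ ≤ t₁) (hfb : ∃ C, ∀ x u, ‖f x u‖ ≤ C)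
    (hFc : Continuous fun p : EuclideanSpace ℝ (Fin d) × EuclideanSpace ℝ (Fin m) => F p.1 p.2)
    (hFb : ∃ C, ∀ x u, ‖F x u‖ ≤ C) :
    IntervalIntegrable (fun r => F (y r) (u r)) volume t₀ t₁ := by
  obtain ⟨C, hC⟩ := hfb
  obtain ⟨D, hD⟩ := hFb
  have hy : AEStronglyMeasurable y (volume.restrict (Icc t₀ t₁)) :=
    aestronglyMeasurable_of_eq_add_integral (fun r => hC (y r) (u r)) h.2.2.2
  have hmeas : AEStronglyMeasurable (fun r => F (y r) (u r)) (volume.restrict (Icc t₀ t₁)) :=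
    hFc.comp_aestronglyMeasurable (hy.prodMk h.1.aestronglyMeasurable)
  rw [intervalIntegrable_iff_integrableOn_Icc_of_le ht]
  exact ⟨hmeas, HasFiniteIntegral.of_bounded
    (Filter.Eventually.of_forall fun r => hD (y r) (u r))⟩

theorem IsAdmissible.restrict_left (h : IsAdmissible X U f t₀ t₁ y u) (hs : s ≤ t₁) :
    IsAdmissible X U f t₀ s y u :=
  ⟨h.1, fun r hr => h.2.1 r ⟨hr.1, hr.2.trans hs⟩, fun r hr => h.2.2.1 r ⟨hr.1, hr.2.trans hs⟩,
    fun r hr => h.2.2.2 r ⟨hr.1, hr.2.trans hs⟩⟩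

theorem IsAdmissible.restrict_right (h : IsAdmissible X U f t₀ t₁ y u) (hs : s ∈ Icc t₀ t₁)
    (hfc : Continuous fun p : EuclideanSpace ℝ (Fin d) × EuclideanSpace ℝ (Fin m) => f p.1 p.2)
    (hfb : ∃ C, ∀ x u, ‖f x u‖ ≤ C) :
    IsAdmissible X U f s t₁ y u := by
  refine ⟨h.1, fun r hr => h.2.1 r ⟨hs.1.trans hr.1, hr.2⟩,
    fun r hr => h.2.2.1 r ⟨hs.1.trans hr.1, hr.2⟩, fun r hr => ?_⟩
  have hs_int := (h.restrict_left hs.2).intervalIntegrable hs.1 hfb hfc hfb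
  have hr_int := (h.restrict_left hr.2).intervalIntegrable (hs.1.trans hr.1) hfb hfc hfb
  rw [h.2.2.2 r ⟨hs.1.trans hr.1, hr.2⟩, h.2.2.2 s hs, add_assoc,
    intervalIntegral.integral_add_adjacent_intervals hs_int (hs_int.symm.trans hr_int)]

/-- The payoff of an admissible pair is at most the sum of the two value functions at any point of
its trajectory. -/
theorem IsAdmissible.payoff_le_vFor_add_vBack {T : ℝ}
    {ℓ : EuclideanSpace ℝ (Fin d) → EuclideanSpace ℝ (Fin m) → ℝ}
    {φ₀ φT : EuclideanSpace ℝ (Fin d) → ℝ}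
    (h : IsAdmissible X U f 0 T y u) (hs : s ∈ Icc 0 T)
    (hℓc : Continuous fun p : EuclideanSpace ℝ (Fin d) × EuclideanSpace ℝ (Fin m) => ℓ p.1 p.2)
    (hℓb : ∃ C, ∀ x u, |ℓ x u| ≤ C)
    (hfc : Continuous fun p : EuclideanSpace ℝ (Fin d) × EuclideanSpace ℝ (Fin m) => f p.1 p.2)
    (hfb : ∃ C, ∀ x u, ‖f x u‖ ≤ C) :
    (((∫ r in (0:ℝ)..T, ℓ (y r) (u r)) + φ₀ (y 0) + φT (y T) : ℝ) : EReal)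
      ≤ vFor X U f ℓ φ₀ (y s) s + vBack X U f ℓ φT T (y s) s := by
  have hleft := h.restrict_left hs.2
  have hright := h.restrict_right hs hfc hfb
  have hFor : (((∫ r in (0:ℝ)..s, ℓ (y r) (u r)) + φ₀ (y 0) : ℝ) : EReal)
      ≤ vFor X U f ℓ φ₀ (y s) s :=
    le_iSup₂_of_le (y, u) ⟨hleft, rfl⟩ le_rfl
  have hBack : (((∫ r in s..T, ℓ (y r) (u r)) + φT (y T) : ℝ) : EReal)
      ≤ vBack X U f ℓ φT T (y s) s :=
    le_iSup₂_of_le (y, u) ⟨hright, rfl⟩ le_rfl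
  refine le_trans (le_of_eq ?_) (add_le_add hFor hBack)
  rw [← EReal.coe_add, ← intervalIntegral.integral_add_adjacent_intervals
    (hleft.intervalIntegrable hs.1 hfb hℓc hℓb) (hright.intervalIntegrable hs.2 hfb hℓc hℓb)]
  congr 1
  ring

end Admissible

/-- Proposition 2.4: restricting the trajectories to the `η`-neighborhood
`O^s_η = {x ∈ X ∣ v→(x,s) + v←(x,s) > v* - η}` of the optimal trajectories does not
change the optimal value: `v*_η = v*`. -/
theorem reduced_value_eq_value {d m : ℕ}
    (T : ℝ) (hT : 0 < T)
    (X : Set (EuclideanSpace ℝ (Fin d))) (hX : Bornology.IsBounded X)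
    (U : Set (EuclideanSpace ℝ (Fin m)))
    (ℓ : EuclideanSpace ℝ (Fin d) → EuclideanSpace ℝ (Fin m) → ℝ)
    (hℓc : Continuous fun p : EuclideanSpace ℝ (Fin d) × EuclideanSpace ℝ (Fin m) => ℓ p.1 p.2)
    (hℓb : ∃ C, ∀ x u, |ℓ x u| ≤ C)
    (f : EuclideanSpace ℝ (Fin d) → EuclideanSpace ℝ (Fin m) → EuclideanSpace ℝ (Fin d))
    (hfc : Continuous fun p : EuclideanSpace ℝ (Fin d) × EuclideanSpace ℝ (Fin m) => f p.1 p.2)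
    (hfb : ∃ C, ∀ x u, ‖f x u‖ ≤ C)
    (φ₀ φT : EuclideanSpace ℝ (Fin d) → ℝ)
    (hφ₀c : Continuous φ₀) (hφ₀b : ∃ C, ∀ x, |φ₀ x| ≤ C)
    (hφTc : Continuous φT) (hφTb : ∃ C, ∀ x, |φT x| ≤ C)
    (hex : ∃ xs us, IsAdmissible X U f 0 T xs us ∧
      (((∫ s in (0:ℝ)..T, ℓ (xs s) (us s)) + φ₀ (xs 0) + φT (xs T) : ℝ) : EReal)
        = vStar X U f ℓ φ₀ φT T)
    (hfin : ∃ r : ℝ, vStar X U f ℓ φ₀ φT T = (r : EReal))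
    (η : ℝ) (hη : 0 < η) :
    (⨆ (p : (ℝ → EuclideanSpace ℝ (Fin d)) × (ℝ → EuclideanSpace ℝ (Fin m)))
      (_ : IsAdmissible X U f 0 T p.1 p.2 ∧ ∀ s ∈ Icc (0:ℝ) T,
        vFor X U f ℓ φ₀ (p.1 s) s + vBack X U f ℓ φT T (p.1 s) s >
          vStar X U f ℓ φ₀ φT T - (η : EReal)),
        (((∫ s in (0:ℝ)..T, ℓ (p.1 s) (p.2 s)) + φ₀ (p.1 0) + φT (p.1 T) : ℝ) : EReal))
      = vStar X U f ℓ φ₀ φT T := by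
  obtain ⟨xs, us, hadm, hopt⟩ := hex
  obtain ⟨r, hr⟩ := hfin
  refine le_antisymm (iSup_mono fun p => iSup_mono' fun hp => ⟨hp.1, le_rfl⟩) ?_
  refine le_iSup₂_of_le (xs, us) ⟨hadm, fun s hs => ?_⟩ hopt.ge
  have hle := hadm.payoff_le_vFor_add_vBack (φ₀ := φ₀) (φT := φT) hs hℓc hℓb hfc hfb
  rw [hopt] at hle
  refine lt_of_lt_of_le ?_ hle
  rw [hr, ← EReal.coe_sub, EReal.coe_lt_coe_iff]
  exact sub_lt_self r hη
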